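/- For p > 1 with conjugate p̂ and positive reals φ ≥ ψ, one has φ^(1/p̂) - ψ^(1/p̂) ≤ (p-1) · φ · (ψ^(-1/p) - φ^(-1/p)). -/

import Mathlib

/-- For conjugate exponents `p, p̂` and `0 < ψ ≤ φ`:
`φ^(1/p̂) - ψ^(1/p̂) ≤ (p-1)·φ·(ψ^(-1/p) - φ^(-1/p))`. -/
theorem rpow_diff_le (p q φ ψ : ℝ) (hp : 1 < p) (hpq : 1 / p + 1 / q = 1)
    (hψ : 0 < ψ) (hφψ : ψ ≤ φ) :
    φ ^ (1 / q) - ψ ^ (1 / q) ≤ (p - 1) * φ * (ψ ^ (-(1 / p)) - φ ^ (-(1 / p))) := by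
  have hφ : 0 < φ := lt_of_lt_of_le hψ hφψ
  have hp0 : 0 < p := by linarith
  have h1 : 1 / p < 1 := by rw [div_lt_one hp0]; exact hp
  have hq : 1 / q = 1 - 1 / p := by linarith
  have key := Real.geom_mean_le_arith_mean2_weighted (w₁ := 1 / p) (w₂ := 1 - 1 / p)
    (by positivity) (by linarith) hψ.le hφ.le (by ring)
  rw [hq]
  rw [Real.rpow_sub hφ, Real.rpow_one] at key ⊢
  rw [Real.rpow_sub hψ, Real.rpow_one, Real.rpow_neg hψ.le, Real.rpow_neg hφ.le]
  have ha : 0 < ψ ^ (1 / p) := Real.rpow_pos_of_pos hψ _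
  have hb : 0 < φ ^ (1 / p) := Real.rpow_pos_of_pos hφ _
  generalize ψ ^ (1 / p) = a at *
  generalize φ ^ (1 / p) = b at *
  have k2 := mul_le_mul_of_nonneg_left key (show 0 ≤ p / a by positivity)
  have e1 : p / a * (a * (φ / b)) = p * φ * b⁻¹ := by field_simp
  have e2 : p / a * (1 / p * ψ + (1 - 1 / p) * φ) = (ψ + (p - 1) * φ) * a⁻¹ := by
    field_simp
  rw [e1, e2] at k2
  rw [div_eq_mul_inv, div_eq_mul_inv]
  linarith
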